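/- arXiv:2209.08051 — 2 statements merged into one kernel-verified Lean document; each statement's English description precedes it below -/
import Mathlib

section
/- Let P be a real symmetric positive definite 2n×2n matrix that is symplectic (Pᵀ J P = J). Then there exist a matrix U ∈ Sp(2n,ℝ) with UᵀU = I (a symplectic rotation) and positive real numbers λ₁,…,λₙ such that P = Uᵀ Δ U, where Δ is the diagonal matrix diag(λ₁,…,λₙ, λ₁⁻¹,…,λₙ⁻¹) (in the z = (x,p) coordinate ordering); in particular Δ is itself symplectic. -/
open Matrix

noncomputable section

/-- The standard symplectic matrix `[[0, I],[-I, 0]]` in the `z = (x,p)` ordering. -/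
def Jmat (n : ℕ) : Matrix (Fin n ⊕ Fin n) (Fin n ⊕ Fin n) ℝ :=
  Matrix.fromBlocks 0 1 (-1) 0

/-- A real matrix is symplectic if `Sᵀ J S = J`. -/
def IsSymplectic (n : ℕ) (S : Matrix (Fin n ⊕ Fin n) (Fin n ⊕ Fin n) ℝ) : Prop :=
  Sᵀ * Jmat n * S = Jmat n

/-- A symmetric positive operator `T` compatible with an orthogonal complex structure `C`
has an orthonormal isotropic family of eigenvectors of every size `k` with `2 * k ≤ dim E`. -/
theorem exists_isotropic_orthonormal_eigenvectors {E : Type*} [NormedAddCommGroup E]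
    [InnerProductSpace ℝ E] [FiniteDimensional ℝ E] (T C : E →ₗ[ℝ] E) (hT : T.IsSymmetric)
    (hTpos : ∀ x, x ≠ 0 → 0 < inner ℝ x (T x)) (hC : ∀ x y, inner ℝ (C x) y = -inner ℝ x (C y))
    (hTC : ∀ x, T (C (T x)) = C x) (k : ℕ) (hk : 2 * k ≤ Module.finrank ℝ E) :
    ∃ (e : Fin k → E) (lam : Fin k → ℝ), Orthonormal ℝ e ∧ (∀ i j, inner ℝ (e i) (C (e j)) = 0) ∧
      (∀ i, 0 < lam i) ∧ ∀ i, T (e i) = lam i • e i := by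
  induction k with
  | zero => exact ⟨Fin.elim0, Fin.elim0, ⟨fun i => i.elim0, fun i => i.elim0⟩,
      fun i => i.elim0, fun i => i.elim0, fun i => i.elim0⟩
  | succ k ih =>
    obtain ⟨e, lam, he, hiso, hlam, heig⟩ := ih (by omega)
    let A : E →ₗ[ℝ] (Fin k ⊕ Fin k → ℝ) :=
      LinearMap.pi fun s => innerₛₗ ℝ (Sum.elim e (fun i => C (e i)) s)
    have hmem : ∀ x, x ∈ LinearMap.ker A ↔
        (∀ i, inner ℝ (e i) x = 0) ∧ ∀ i, inner ℝ (C (e i)) x = 0 := by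
      intro x
      simp [A, LinearMap.mem_ker, funext_iff]
    have hinv : ∀ x ∈ LinearMap.ker A, T x ∈ LinearMap.ker A := by
      intro x hx
      rw [hmem] at hx ⊢
      refine ⟨fun i => ?_, fun i => ?_⟩
      · rw [← hT, heig, inner_smul_left, hx.1, mul_zero]
      · have h := hTC (e i)
        rw [heig, map_smul, map_smul] at h
        have h0 := hx.2 i
        rw [← h, inner_smul_left, hT] at h0
        simpa [(hlam i).ne'] using h0
    have hne : LinearMap.ker A ≠ ⊥ := by
      apply LinearMap.ker_ne_bot_of_finrank_lt
      simp only [Module.finrank_fintype_fun_eq_card, Fintype.card_sum, Fintype.card_fin]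
      omega
    have : Nontrivial (LinearMap.ker A) := Submodule.nontrivial_iff_ne_bot.mpr hne
    obtain ⟨v, hv⟩ :=
      (hT.restrict_invariant hinv).hasEigenvalue_iSup_of_finiteDimensional.exists_hasEigenvector
    generalize (⨆ x : { x : LinearMap.ker A // x ≠ 0 }, _ : ℝ) = μ at hv
    have hv0 : (v : E) ≠ 0 := fun h => hv.2 (Subtype.ext h)
    have hTv : T v = μ • (v : E) := congrArg Subtype.val hv.apply_eq_smul
    obtain ⟨h1, h2⟩ := (hmem v).1 v.2
    have hμ : 0 < μ := by
      have h := hTpos v hv0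
      rw [hTv, inner_smul_right] at h
      exact pos_of_mul_pos_left h real_inner_self_nonneg
    have hvC : inner ℝ (v : E) (C v) = 0 := by
      have h := hC v v
      rw [real_inner_comm] at h
      linarith
    refine ⟨Fin.cons (‖(v : E)‖⁻¹ • (v : E)) e, Fin.cons μ lam, ?_, ?_, ?_, ?_⟩
    · refine ⟨fun i => ?_, fun i j hij => ?_⟩
      · induction i using Fin.cases
        · simp [norm_smul, hv0]
        · simpa using he.1 _
      · induction i using Fin.cases <;> induction j using Fin.cases
        · exact absurd rfl hij
        · rw [Fin.cons_zero, Fin.cons_succ, inner_smul_left, real_inner_comm, h1, mul_zero]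
        · simp [inner_smul_right, h1]
        · simpa using he.2 (fun h => hij (congrArg _ h))
    · intro i j
      induction i using Fin.cases <;> induction j using Fin.cases
      · simp [inner_smul_left, inner_smul_right, hvC]
      · rw [Fin.cons_zero, Fin.cons_succ, inner_smul_left, real_inner_comm, h2, mul_zero]
      · rw [Fin.cons_zero, Fin.cons_succ, map_smul, inner_smul_right, ← neg_neg (inner ℝ _ _),
          ← hC, h2, neg_zero, mul_zero]
      · simpa using hiso _ _
    · exact Fin.cases (by simpa using hμ) (by simpa using hlam)
    · refine Fin.cases ?_ ?_
      · rw [Fin.cons_zero, Fin.cons_zero, map_smul, hTv, smul_comm]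
      · simpa using heig

theorem Jmat_transpose (n : ℕ) : (Jmat n)ᵀ = -Jmat n := by
  simp [Jmat, fromBlocks_transpose, fromBlocks_neg]

theorem Jmat_mul_self (n : ℕ) : Jmat n * Jmat n = -1 := by
  simp [Jmat, fromBlocks_multiply, ← fromBlocks_one, fromBlocks_neg]

theorem isSymplectic_diagonal {n : ℕ} {lam : Fin n → ℝ} (hlam : ∀ i, lam i ≠ 0) :
    IsSymplectic n (diagonal (Sum.elim lam fun i => (lam i)⁻¹)) := by
  have h : diagonal lam * diagonal (fun i => (lam i)⁻¹) = 1 := by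
    simp [diagonal_mul_diagonal, hlam]
  have h' : diagonal (fun i => (lam i)⁻¹) * diagonal lam = 1 := by
    simp [diagonal_mul_diagonal, hlam]
  simp [IsSymplectic, Jmat, ← fromBlocks_diagonal, fromBlocks_transpose, fromBlocks_multiply,
    h, h', -diagonal_mul_diagonal, -diagonal_neg]

/-- A symmetric positive definite symplectic matrix has an orthogonal eigenbasis which
commutes with the standard symplectic matrix. -/
theorem exists_orthogonal_commute_Jmat_diagonalizing {n : ℕ}
    {P : Matrix (Fin n ⊕ Fin n) (Fin n ⊕ Fin n) ℝ} (hpos : P.PosDef)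
    (hPJ : P * Jmat n * P = Jmat n) :
    ∃ (W : Matrix (Fin n ⊕ Fin n) (Fin n ⊕ Fin n) ℝ) (lam : Fin n → ℝ), (∀ i, 0 < lam i) ∧
      Wᵀ * W = 1 ∧ Jmat n * W = W * Jmat n ∧
      P * W = W * diagonal (Sum.elim lam fun i => (lam i)⁻¹) := by
  have hskew : ∀ x y : EuclideanSpace ℝ (Fin n ⊕ Fin n),
      inner ℝ ((Jmat n).toEuclideanLin x) y = -inner ℝ x ((Jmat n).toEuclideanLin y) := by
    intro x y
    simp only [EuclideanSpace.inner_eq_star_dotProduct, star_trivial, ofLp_toLpLin, toLin'_apply]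
    rw [dotProduct_mulVec, ← mulVec_transpose, Jmat_transpose, neg_mulVec, neg_dotProduct]
  obtain ⟨e, lam, he, hiso, hlam, heig⟩ := exists_isotropic_orthonormal_eigenvectors
    P.toEuclideanLin (Jmat n).toEuclideanLin (isSymmetric_toEuclideanLin_iff.mpr hpos.isHermitian)
    (by
      intro x hx
      simpa [EuclideanSpace.inner_eq_star_dotProduct, dotProduct_comm] using
        hpos.dotProduct_mulVec_pos (x := x.ofLp) (by simpa using hx)) hskew
    (by
      intro x
      apply (WithLp.ofLp_injective 2)
      simp [hPJ, ← Matrix.mul_assoc]) n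
    (by simp [two_mul])
  have hdot : ∀ i j, e i ⬝ᵥ e j = if i = j then 1 else 0 := by
    intro i j
    have := orthonormal_iff_ite.mp he j i
    simpa [EuclideanSpace.inner_eq_star_dotProduct, eq_comm] using this
  have hdotJ : ∀ i j, e i ⬝ᵥ Jmat n *ᵥ e j = 0 := by
    intro i j
    simpa [EuclideanSpace.inner_eq_star_dotProduct, dotProduct_comm] using hiso i j
  have hdotJJ : ∀ i j, (Jmat n *ᵥ e i) ⬝ᵥ (Jmat n *ᵥ e j) = if i = j then 1 else 0 := by
    intro i j
    rw [dotProduct_mulVec, ← mulVec_transpose, mulVec_mulVec, Jmat_transpose, Matrix.neg_mul,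
      Jmat_mul_self, neg_neg, one_mulVec, hdot]
  have hP : ∀ i, P *ᵥ e i = lam i • (e i).ofLp := fun i => by
    simpa using congrArg WithLp.ofLp (heig i)
  have hPJe : ∀ i, P *ᵥ (Jmat n *ᵥ e i) = (lam i)⁻¹ • (Jmat n *ᵥ e i) := by
    intro i
    have h := congrArg (· *ᵥ (e i).ofLp) hPJ
    simp only [← mulVec_mulVec, hP, mulVec_smul] at h
    exact (inv_smul_eq_iff₀ (hlam i).ne').mpr h.symm |>.symm
  let F : Fin n ⊕ Fin n → Fin n ⊕ Fin n → ℝ :=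
    Sum.elim (fun i => (e i).ofLp) (fun i => -(Jmat n *ᵥ e i))
  refine ⟨(of F)ᵀ, lam, hlam, ?_, ?_, ?_⟩
  · ext a b
    change F a ⬝ᵥ F b = _
    rcases a with a | a <;> rcases b with b | b
    · simp [F, hdot, one_apply]
    · simp [F, hdotJ]
    · simp [F, dotProduct_comm _ (e b).ofLp, hdotJ]
    · simp [F, hdotJJ, one_apply]
  · ext a b
    change (Jmat n *ᵥ F b) a = ((of F)ᵀ * Jmat n) a b
    rcases b with b | b
    · simp [F, Jmat, mul_apply, one_apply]
    · have h : Jmat n *ᵥ F (Sum.inr b) = e b := by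
        simp only [F, Sum.elim_inr, mulVec_neg, mulVec_mulVec, Jmat_mul_self, neg_mulVec,
          one_mulVec, neg_neg]
      rw [h]
      simp [F, Jmat, mul_apply, one_apply]
  · ext a b
    rw [mul_diagonal]
    change (P *ᵥ F b) a = F b a * _
    rcases b with b | b
    · simp [F, hP, mul_comm]
    · simp [F, mulVec_neg, hPJe, mul_comm]

/-- A real symmetric positive definite symplectic matrix `P` can be
diagonalized as `P = Uᵀ Δ U` with `U` a symplectic rotation and
`Δ = diag(λ₁,…,λₙ,λ₁⁻¹,…,λₙ⁻¹)` with all `λᵢ > 0`; in particular `Δ` is symplectic. -/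
theorem toeplitz_stmt6 (n : ℕ)
    (P : Matrix (Fin n ⊕ Fin n) (Fin n ⊕ Fin n) ℝ)
    (hP : P.IsSymm) (hpos : P.PosDef)
    (hsymp : IsSymplectic n P) :
    ∃ U : Matrix (Fin n ⊕ Fin n) (Fin n ⊕ Fin n) ℝ, IsSymplectic n U ∧ Uᵀ * U = 1 ∧
      ∃ lam : Fin n → ℝ, (∀ i, 0 < lam i) ∧
        P = Uᵀ * Matrix.diagonal (Sum.elim lam (fun i => (lam i)⁻¹)) * U ∧
        IsSymplectic n (Matrix.diagonal (Sum.elim lam (fun i => (lam i)⁻¹))) := by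
  rw [IsSymplectic, hP.eq] at hsymp
  obtain ⟨W, lam, hlam, hW, hJW, hPW⟩ := exists_orthogonal_commute_Jmat_diagonalizing hpos hsymp
  have hW' : W * Wᵀ = 1 := mul_eq_one_comm.mp hW
  refine ⟨Wᵀ, ?_, ?_, lam, hlam, ?_, isSymplectic_diagonal fun i => (hlam i).ne'⟩
  · rw [IsSymplectic, transpose_transpose, ← hJW, Matrix.mul_assoc, hW', Matrix.mul_one]
  · rw [transpose_transpose, hW']
  · rw [transpose_transpose, ← hPW, Matrix.mul_assoc, hW', Matrix.mul_one]
end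
end

section
/- Let ħ > 0 and let X, Y be real symmetric n×n matrices with X positive definite. Define the normalized Gaussian φ_{X,Y}(x) = (πħ)^{-n/4} (det X)^{1/4} e^{−(X+iY)x·x/(2ħ)}. Then for every z = (x,p) ∈ ℝ²ⁿ, Wφ_{X,Y}(z) = (πħ)^{-n} e^{−G z·z/ħ}, where G is the symmetric positive definite symplectic matrix G = [[X + Y X⁻¹ Y, Y X⁻¹],[X⁻¹ Y, X⁻¹]] (in the z = (x,p) ordering). -/
open MeasureTheory Matrix Complex

noncomputable section

/-- The `ħ`-dependent cross-Wigner transform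
`W(ψ,φ)(x,p) = (2πħ)^{-n} ∫ e^{-ip·y/ħ} ψ(x+y/2) conj(φ(x-y/2)) dy` on `ℝⁿ`. -/
def crossWigner (n : ℕ) (hbar : ℝ) (ψ φ : (Fin n → ℝ) → ℂ) (x p : Fin n → ℝ) : ℂ :=
  ((2 * Real.pi * hbar) ^ n)⁻¹ *
    ∫ y : Fin n → ℝ,
      Complex.exp (-(Complex.I * (((p ⬝ᵥ y) / hbar : ℝ) : ℂ))) *
        ψ (x + y / 2) * (starRingEnd ℂ) (φ (x - y / 2))

/-- The normalized generalized Gaussian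
`φ_{X,Y}(x) = (πħ)^{-n/4} (det X)^{1/4} e^{-(X+iY)x·x/(2ħ)}`. -/
def gaussXY (n : ℕ) (hbar : ℝ) (X Y : Matrix (Fin n) (Fin n) ℝ) (x : Fin n → ℝ) : ℂ :=
  (((Real.pi * hbar) ^ (-(n : ℝ) / 4) * X.det ^ ((1 : ℝ) / 4) : ℝ) : ℂ) *
    Complex.exp (-(((X.map (fun t => (t : ℂ)) + Complex.I • Y.map (fun t => (t : ℂ)))
        *ᵥ (fun j => ((x j : ℝ) : ℂ))) ⬝ᵥ (fun j => ((x j : ℝ) : ℂ))) / (2 * (hbar : ℂ)))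

/-- A real positive definite matrix factors as `Cᵀ * C` with `C` invertible. -/
theorem Matrix.PosDef.exists_transpose_mul_self {n : ℕ} {X : Matrix (Fin n) (Fin n) ℝ}
    (hX : X.PosDef) : ∃ C : Matrix (Fin n) (Fin n) ℝ, C.det ≠ 0 ∧ X = Cᵀ * C := by
  open scoped MatrixOrder Matrix.Norms.L2Operator in
  obtain ⟨C, hC⟩ := CStarAlgebra.nonneg_iff_eq_star_mul_self.mp hX.posSemidef.nonneg
  rw [star_eq_conjTranspose, conjTranspose_eq_transpose_of_trivial] at hC
  refine ⟨C, fun h => ?_, hC⟩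
  have hdet := hX.det_pos
  rw [hC, det_mul, h, mul_zero] at hdet
  exact lt_irrefl _ hdet

/-- Linear change of variables for the Lebesgue integral on `ℝⁿ`. -/
theorem integral_comp_mulVec {n : ℕ} {C : Matrix (Fin n) (Fin n) ℝ} (hC : C.det ≠ 0)
    (g : (Fin n → ℝ) → ℂ) :
    ∫ y, g (C *ᵥ y) = ((|C.det|⁻¹ : ℝ) : ℂ) * ∫ u, g u := by
  have hemb : MeasurableEmbedding (toLin' C) := by
    refine (LinearMap.continuous_of_finiteDimensional _).measurableEmbedding ?_
    exact mulVec_injective_of_isUnit ((isUnit_iff_isUnit_det C).2 hC.isUnit)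
  have h := hemb.integral_map (μ := volume) g
  rw [Real.map_matrix_volume_pi_eq_smul_volume_pi hC, integral_smul_measure,
    ENNReal.toReal_ofReal (abs_nonneg _), abs_inv] at h
  simpa [toLin'_apply] using h.symm

/-- Fourier transform of a Gaussian with positive definite matrix. -/
theorem integral_cexp_neg_mul_dotProduct_mulVec_add {n : ℕ} {X : Matrix (Fin n) (Fin n) ℝ}
    (hX : X.PosDef) {b : ℝ} (hb : 0 < b) (q : Fin n → ℝ) :
    ∫ y : Fin n → ℝ,
        cexp (-(b : ℂ) * (((X *ᵥ y) ⬝ᵥ y : ℝ) : ℂ) - I * ((q ⬝ᵥ y : ℝ) : ℂ)) =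
      (((Real.pi / b) ^ ((n : ℝ) / 2) * (X.det ^ ((1 : ℝ) / 2))⁻¹ *
        Real.exp (-((X⁻¹ *ᵥ q) ⬝ᵥ q) / (4 * b)) : ℝ) : ℂ) := by
  obtain ⟨C, hC, rfl⟩ := hX.exists_transpose_mul_self
  have hCu : IsUnit C.det := hC.isUnit
  set r : Fin n → ℝ := q ᵥ* C⁻¹ with hr
  let g : (Fin n → ℝ) → ℂ := fun u =>
    cexp (-(b : ℂ) * ∑ i, (u i : ℂ) ^ 2 + ∑ i, (-I * r i) * u i)
  have hfun : ∀ y : Fin n → ℝ,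
      cexp (-(b : ℂ) * ((((Cᵀ * C) *ᵥ y) ⬝ᵥ y : ℝ) : ℂ) - I * ((q ⬝ᵥ y : ℝ) : ℂ)) =
      g (C *ᵥ y) := by
    intro y
    simp only [g]
    have h1 : ((Cᵀ * C) *ᵥ y) ⬝ᵥ y = ∑ i, (C *ᵥ y) i ^ 2 := by
      rw [← mulVec_mulVec, mulVec_transpose, ← dotProduct_mulVec]
      simp [dotProduct, sq]
    have h2 : q ⬝ᵥ y = ∑ i, r i * (C *ᵥ y) i := by
      change _ = r ⬝ᵥ (C *ᵥ y)
      rw [hr, dotProduct_mulVec, vecMul_vecMul, nonsing_inv_mul _ hCu, vecMul_one]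
    rw [h1, h2]
    push_cast
    simp only [mul_assoc, ← Finset.mul_sum]
    ring_nf
  have hq : ((Cᵀ * C)⁻¹ *ᵥ q) ⬝ᵥ q = ∑ i, r i ^ 2 := by
    have : (Cᵀ * C)⁻¹ = C⁻¹ * (C⁻¹)ᵀ := by rw [Matrix.mul_inv_rev, transpose_nonsing_inv]
    rw [this, ← mulVec_mulVec, mulVec_transpose, dotProduct_comm, dotProduct_mulVec]
    simp [dotProduct, sq, hr]
  have hdet : (Cᵀ * C).det ^ ((1 : ℝ) / 2) = |C.det| := by
    rw [det_mul, det_transpose, ← Real.sqrt_eq_rpow, Real.sqrt_mul_self_eq_abs]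
  have hpow : ((Real.pi : ℂ) / b) ^ ((Fintype.card (Fin n) : ℂ) / 2) =
      (((Real.pi / b) ^ ((n : ℝ) / 2) : ℝ) : ℂ) := by
    rw [Complex.ofReal_cpow (by positivity)]
    simp
  refine (integral_congr_ae (.of_forall hfun)).trans ((integral_comp_mulVec hC g).trans ?_)
  rw [GaussianFourier.integral_cexp_neg_mul_sum_add (by simpa using hb),
    hpow, hq, hdet]
  have hsum : ∑ i, (-I * (r i : ℂ)) ^ 2 = -∑ i, (r i : ℂ) ^ 2 := by
    simp [mul_pow]
  rw [hsum]
  push_cast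
  ring

/-- The quadratic form of the block matrix `[[X+YX⁻¹Y, YX⁻¹],[X⁻¹Y, X⁻¹]]`, with the square
completed in the momentum variable. -/
theorem fromBlocks_mulVec_dotProduct_self {n : ℕ} {X Y : Matrix (Fin n) (Fin n) ℝ}
    (hY : Y.IsSymm) (x p : Fin n → ℝ) :
    ((fromBlocks (X + Y * X⁻¹ * Y) (Y * X⁻¹) (X⁻¹ * Y) X⁻¹) *ᵥ Sum.elim x p) ⬝ᵥ Sum.elim x p =
      (X *ᵥ x) ⬝ᵥ x + (X⁻¹ *ᵥ (p + Y *ᵥ x)) ⬝ᵥ (p + Y *ᵥ x) := by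
  have hYdot : ∀ u v : Fin n → ℝ, (Y *ᵥ u) ⬝ᵥ v = u ⬝ᵥ (Y *ᵥ v) := fun u v => by
    rw [dotProduct_mulVec, ← mulVec_transpose, hY.eq]
  simp only [fromBlocks_mulVec, Sum.elim_comp_inl, Sum.elim_comp_inr, sumElim_dotProduct_sumElim,
    add_mulVec, mulVec_add, add_dotProduct, dotProduct_add, ← mulVec_mulVec, hYdot]
  ring

/-- The exponent of the generalized Gaussian, split into real and imaginary parts. -/
theorem gaussXY_eq (n : ℕ) (hbar : ℝ) (X Y : Matrix (Fin n) (Fin n) ℝ) (x : Fin n → ℝ) :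
    gaussXY n hbar X Y x =
      (((Real.pi * hbar) ^ (-(n : ℝ) / 4) * X.det ^ ((1 : ℝ) / 4) : ℝ) : ℂ) *
        cexp (-((((X *ᵥ x) ⬝ᵥ x : ℝ) : ℂ) + I * (((Y *ᵥ x) ⬝ᵥ x : ℝ) : ℂ)) / (2 * (hbar : ℂ))) := by
  have hmap : ∀ A : Matrix (Fin n) (Fin n) ℝ,
      (A.map (fun t => (t : ℂ)) *ᵥ (fun j => ((x j : ℝ) : ℂ))) ⬝ᵥ (fun j => ((x j : ℝ) : ℂ)) =
        (((A *ᵥ x) ⬝ᵥ x : ℝ) : ℂ) := fun A => by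
    simp [dotProduct, mulVec]
  rw [gaussXY, add_mulVec, add_dotProduct, smul_mulVec, smul_dotProduct, hmap, hmap, smul_eq_mul]

/-- The quadratic identities for a symmetric matrix evaluated at `x ± y/2`. -/
theorem mulVec_dotProduct_add_half {n : ℕ} {A : Matrix (Fin n) (Fin n) ℝ} (hA : A.IsSymm)
    (x y : Fin n → ℝ) :
    (A *ᵥ (x + y / 2)) ⬝ᵥ (x + y / 2) =
        (A *ᵥ x) ⬝ᵥ x + (A *ᵥ x) ⬝ᵥ y + (A *ᵥ y) ⬝ᵥ y / 4 ∧
      (A *ᵥ (x - y / 2)) ⬝ᵥ (x - y / 2) =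
        (A *ᵥ x) ⬝ᵥ x - (A *ᵥ x) ⬝ᵥ y + (A *ᵥ y) ⬝ᵥ y / 4 := by
  have hy : y / 2 = (2⁻¹ : ℝ) • y := by
    ext i
    simp [div_eq_inv_mul]
  have hAdot : (A *ᵥ y) ⬝ᵥ x = (A *ᵥ x) ⬝ᵥ y := by
    rw [dotProduct_comm, dotProduct_mulVec, ← mulVec_transpose, hA.eq]
  rw [hy]
  constructor <;>
  · simp only [mulVec_add, mulVec_sub, mulVec_smul, add_dotProduct, dotProduct_add,
      sub_dotProduct, dotProduct_sub, smul_dotProduct, dotProduct_smul, smul_eq_mul, hAdot]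
    ring

/-- The Wigner transform of the generalized Gaussian, with the square completed. -/
theorem crossWigner_gaussXY {n : ℕ} {hbar : ℝ} (hhbar : 0 < hbar)
    {X Y : Matrix (Fin n) (Fin n) ℝ} (hX : X.IsSymm) (hY : Y.IsSymm) (hXpos : X.PosDef)
    (x p : Fin n → ℝ) :
    crossWigner n hbar (gaussXY n hbar X Y) (gaussXY n hbar X Y) x p =
      ((((Real.pi * hbar) ^ n)⁻¹ * Real.exp (-((X *ᵥ x) ⬝ᵥ x +
        (X⁻¹ *ᵥ (p + Y *ᵥ x)) ⬝ᵥ (p + Y *ᵥ x)) / hbar) : ℝ) : ℂ) := by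
  have hh : (hbar : ℂ) ≠ 0 := by exact_mod_cast hhbar.ne'
  have hpi := Real.pi_pos
  set c : ℝ := (Real.pi * hbar) ^ (-(n : ℝ) / 4) * X.det ^ ((1 : ℝ) / 4) with hc
  set q : Fin n → ℝ := hbar⁻¹ • (p + Y *ᵥ x) with hq
  have hb : 0 < (4 * hbar)⁻¹ := by positivity
  have hint : ∀ y : Fin n → ℝ,
      cexp (-(I * (((p ⬝ᵥ y) / hbar : ℝ) : ℂ))) * gaussXY n hbar X Y (x + y / 2) *
        (starRingEnd ℂ) (gaussXY n hbar X Y (x - y / 2)) =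
      ((c ^ 2 * Real.exp (-((X *ᵥ x) ⬝ᵥ x) / hbar) : ℝ) : ℂ) *
        cexp (-(((4 * hbar)⁻¹ : ℝ) : ℂ) * (((X *ᵥ y) ⬝ᵥ y : ℝ) : ℂ) - I * ((q ⬝ᵥ y : ℝ) : ℂ)) := by
    intro y
    rw [gaussXY_eq, gaussXY_eq, map_mul, ← Complex.exp_conj, ← hc,
      (mulVec_dotProduct_add_half hX x y).1, (mulVec_dotProduct_add_half hX x y).2,
      (mulVec_dotProduct_add_half hY x y).1, (mulVec_dotProduct_add_half hY x y).2]
    simp only [map_div₀, map_neg, map_add, map_mul, conj_ofReal, conj_I, map_ofNat]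
    rw [hq, smul_dotProduct, add_dotProduct, smul_eq_mul]
    push_cast
    have hmerge : ∀ a b d : ℂ, cexp a * (c * cexp b) * (c * cexp d) =
        (c : ℂ) ^ 2 * cexp (a + b + d) := fun a b d => by
      rw [Complex.exp_add, Complex.exp_add]
      ring
    rw [hmerge, mul_assoc, ← Complex.exp_add]
    congr 2
    field_simp
    ring
  have hdet := hXpos.det_pos
  have hconst : ((2 * Real.pi * hbar) ^ n)⁻¹ * (c ^ 2 * ((Real.pi / (4 * hbar)⁻¹) ^ ((n : ℝ) / 2) *
      (X.det ^ ((1 : ℝ) / 2))⁻¹)) = ((Real.pi * hbar) ^ n)⁻¹ := by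
    have hc2 : c ^ 2 = ((Real.pi * hbar) ^ ((n : ℝ) / 2))⁻¹ * X.det ^ ((1 : ℝ) / 2) := by
      rw [hc, mul_pow, ← Real.rpow_mul_natCast (by positivity), ← Real.rpow_mul_natCast hdet.le,
        ← Real.rpow_neg (by positivity)]
      congr 2 <;> push_cast <;> ring
    have h4 : (Real.pi / (4 * hbar)⁻¹) ^ ((n : ℝ) / 2) =
        2 ^ n * (Real.pi * hbar) ^ ((n : ℝ) / 2) := by
      rw [show Real.pi / (4 * hbar)⁻¹ = 2 ^ (2 : ℝ) * (Real.pi * hbar) by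
          rw [div_inv_eq_mul]; norm_num; ring,
        Real.mul_rpow (by positivity) (by positivity), ← Real.rpow_mul (by norm_num),
        mul_div_cancel₀ _ two_ne_zero, Real.rpow_natCast]
    have h1 : (Real.pi * hbar) ^ ((n : ℝ) / 2) ≠ 0 := by positivity
    have h2 : X.det ^ ((1 : ℝ) / 2) ≠ 0 := by positivity
    rw [hc2, h4, mul_assoc 2, mul_pow 2]
    field_simp
  have hexp : (X⁻¹ *ᵥ q) ⬝ᵥ q / (4 * (4 * hbar)⁻¹) =
      (X⁻¹ *ᵥ (p + Y *ᵥ x)) ⬝ᵥ (p + Y *ᵥ x) / hbar := by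
    rw [hq, mulVec_smul, smul_dotProduct, dotProduct_smul, smul_eq_mul, smul_eq_mul]
    field_simp
  rw [crossWigner]
  simp_rw [hint]
  rw [integral_const_mul, integral_cexp_neg_mul_dotProduct_mulVec_add hXpos hb, ← hconst,
    neg_div _ (_ ⬝ᵥ q), hexp, neg_add, add_div, Real.exp_add, neg_div, neg_div]
  push_cast
  ring

/-- The Wigner transform of the generalized Gaussian `φ_{X,Y}` is
`Wφ_{X,Y}(z) = (πħ)^{-n} e^{-Gz·z/ħ}`, where `G = [[X+YX⁻¹Y, YX⁻¹],[X⁻¹Y, X⁻¹]]` is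
symmetric, positive definite and symplectic. -/
theorem toeplitz_stmt10 (n : ℕ) (hbar : ℝ) (hhbar : 0 < hbar)
    (X Y : Matrix (Fin n) (Fin n) ℝ)
    (hX : X.IsSymm) (hY : Y.IsSymm) (hXpos : X.PosDef) :
    (Matrix.fromBlocks (X + Y * X⁻¹ * Y) (Y * X⁻¹) (X⁻¹ * Y) X⁻¹).IsSymm ∧
    (Matrix.fromBlocks (X + Y * X⁻¹ * Y) (Y * X⁻¹) (X⁻¹ * Y) X⁻¹).PosDef ∧
    (Matrix.fromBlocks (X + Y * X⁻¹ * Y) (Y * X⁻¹) (X⁻¹ * Y) X⁻¹)ᵀ * Jmat n *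
      (Matrix.fromBlocks (X + Y * X⁻¹ * Y) (Y * X⁻¹) (X⁻¹ * Y) X⁻¹) = Jmat n ∧
    ∀ x p : Fin n → ℝ,
      crossWigner n hbar (gaussXY n hbar X Y) (gaussXY n hbar X Y) x p
        = ((((Real.pi * hbar) ^ n)⁻¹ *
            Real.exp (-(((Matrix.fromBlocks (X + Y * X⁻¹ * Y) (Y * X⁻¹) (X⁻¹ * Y) X⁻¹)
              *ᵥ (Sum.elim x p)) ⬝ᵥ (Sum.elim x p)) / hbar) : ℝ) : ℂ) := by
  have hXdet : IsUnit X.det := hXpos.det_pos.ne'.isUnit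
  have hXi : (X⁻¹)ᵀ = X⁻¹ := by rw [transpose_nonsing_inv, hX.eq]
  have hsymm : (fromBlocks (X + Y * X⁻¹ * Y) (Y * X⁻¹) (X⁻¹ * Y) X⁻¹).IsSymm := by
    rw [IsSymm, fromBlocks_transpose]
    simp only [transpose_add, transpose_mul, hX.eq, hY.eq, hXi, Matrix.mul_assoc]
  refine ⟨hsymm, ?_, ?_, fun x p => ?_⟩
  · refine .of_dotProduct_mulVec_pos (by
      rw [IsHermitian, conjTranspose_eq_transpose_of_trivial, hsymm.eq]) fun z hz => ?_
    have hpos : ∀ {A : Matrix (Fin n) (Fin n) ℝ}, A.PosDef → ∀ v, v ≠ 0 → 0 < (A *ᵥ v) ⬝ᵥ v :=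
      fun hA v hv => by simpa [dotProduct_comm] using hA.dotProduct_mulVec_pos hv
    have hnonneg : 0 ≤ (X⁻¹ *ᵥ (z ∘ Sum.inr + Y *ᵥ (z ∘ Sum.inl))) ⬝ᵥ
        (z ∘ Sum.inr + Y *ᵥ (z ∘ Sum.inl)) := by
      simpa [dotProduct_comm] using hXpos.inv.posSemidef.dotProduct_mulVec_nonneg
        (z ∘ Sum.inr + Y *ᵥ (z ∘ Sum.inl))
    rw [star_trivial, dotProduct_comm, ← Sum.elim_comp_inl_inr z,
      fromBlocks_mulVec_dotProduct_self hY]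
    by_cases hx : z ∘ Sum.inl = 0
    · have hp : z ∘ Sum.inr ≠ 0 := fun hp => hz <| by
        rw [← Sum.elim_comp_inl_inr z, hx, hp, Sum.elim_zero_zero]
      simpa [hx] using hpos hXpos.inv _ hp
    · exact add_pos_of_pos_of_nonneg (hpos hXpos _ hx) hnonneg
  · rw [hsymm.eq, Jmat, fromBlocks_multiply, fromBlocks_multiply]
    simp only [Matrix.mul_zero, Matrix.mul_one, Matrix.mul_neg, zero_add, add_zero,
      Matrix.neg_mul, Matrix.add_mul, Matrix.mul_add, Matrix.mul_assoc,
      mul_nonsing_inv_cancel_left _ _ hXdet, mul_nonsing_inv _ hXdet, nonsing_inv_mul _ hXdet]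
    congr 1 <;> abel
  · rw [crossWigner_gaussXY hhbar hX hY hXpos, fromBlocks_mulVec_dotProduct_self hY]
end
end
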